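/- Let X be a coherent simplicial complex of rank n ≥ 0 and let h ∈ ΔX. Then θ□_{ΔX}(h) = Δθ□_X(h): the neighborhood of h inside the border of X equals the border of the neighborhood θ□_X(h) of h in X. -/

import Mathlib

namespace PCMPaper

variable {α : Type*} [PartialOrder α]

/-- The set of elements of `X` strictly below `h` (α□_X(h)). -/
def alphaS (X : Set α) (h : α) : Set α := {x ∈ X | x < h}

/-- The set of elements of `X` strictly above `h` (β□_X(h)). -/
def betaS (X : Set α) (h : α) : Set α := {x ∈ X | h < x}

/-- The (strict) neighborhood θ□_X(h) = α□_X(h) ∪ β□_X(h). -/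
def thetaS (X : Set α) (h : α) : Set α := alphaS X h ∪ betaS X h

/-- The rank of `h` in the poset `X`: the maximal length of a strictly increasing
chain in `X` ending at `h`.  (It equals 0 when α□_X(h) = ∅ and
`max_{x ∈ α□_X(h)} rank X x + 1` otherwise, for finite `X`.) -/
noncomputable def rank (X : Set α) (h : α) : ℕ :=
  sSup {n : ℕ | ∃ c : Fin (n + 1) → α, StrictMono c ∧ (∀ i, c i ∈ X) ∧ c (Fin.last n) = h}

open scoped Classical in
/-- The rank of the poset `X`: maximal rank of its elements, `-1` if empty. -/
noncomputable def rankSet (X : Set α) : ℤ :=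
  if X = ∅ then -1 else ((sSup (rank X '' X) : ℕ) : ℤ)

/-- One step of a path in `X`: two distinct comparable elements of `X`. -/
def rel (X : Set α) (x y : α) : Prop :=
  x ∈ X ∧ y ∈ X ∧ x ≠ y ∧ (x < y ∨ y < x)

/-- `X` is (path-)connected: any two elements are joined by a path in `X`. -/
def IsConnected (X : Set α) : Prop :=
  ∀ x ∈ X, ∀ y ∈ X, Relation.ReflTransGen (rel X) x y

/-- `IsSurfaceAux (k + 1) X` means that `X` is a (discrete) `k`-surface. -/
def IsSurfaceAux : ℕ → Set α → Prop
  | 0, X => X = ∅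
  | 1, X => ∃ x y : α, x ≠ y ∧ ¬ x < y ∧ ¬ y < x ∧ X = {x, y}
  | (n + 2), X => X.Nonempty ∧ IsConnected X ∧ ∀ h ∈ X, IsSurfaceAux (n + 1) (thetaS X h)

/-- `X` is a discrete `k`-surface (`k : ℤ`, `k ≥ -1`). -/
def IsSurface (k : ℤ) (X : Set α) : Prop :=
  ∃ n : ℕ, (n : ℤ) = k + 1 ∧ IsSurfaceAux n X

/-- The border ΔX of a poset `X` of rank `n`:
elements whose neighborhood is not an `(n-1)`-surface. -/
def border (X : Set α) : Set α :=
  {h ∈ X | ¬ IsSurface (rankSet X - 1) (thetaS X h)}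

/-- The interior of `X`. -/
def interior' (X : Set α) : Set α := X \ border X

/-- `IsPCMAux (n + 1) X` means that `X` is an `n`-PCM. -/
def IsPCMAux : ℕ → Set α → Prop
  | 0, X => X = ∅
  | 1, X => ∃ x : α, X = {x}
  | (n + 2), X => rankSet X = ((n : ℤ) + 1) ∧ IsConnected X ∧ border X ≠ ∅ ∧
      ∀ h ∈ X, (h ∈ border X → IsPCMAux (n + 1) (thetaS X h)) ∧
               (h ∉ border X → IsSurfaceAux (n + 1) (thetaS X h))

/-- `X` is an `k`-PCM (`k : ℤ`, `k ≥ -1`). -/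
def IsPCM (k : ℤ) (X : Set α) : Prop :=
  ∃ n : ℕ, (n : ℤ) = k + 1 ∧ IsPCMAux n X

/-- Fuel-indexed coherence. -/
def IsCoherentAux : ℕ → Set α → Prop
  | 0, X => X = ∅
  | (n + 1), X => X = ∅ ∨
      ∀ h ∈ X, rankSet (thetaS X h) = rankSet X - 1 ∧ IsCoherentAux n (thetaS X h)

/-- `X` is a coherent poset. -/
def IsCoherent (X : Set α) : Prop := ∃ n : ℕ, IsCoherentAux n X

/-- `X` is a separated union of `(m-1)`-surfaces: a union of `(m-1)`-surfaces such
that no element of one of them is comparable to an element of another one. -/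
def IsSeparatedUnionOfSurfacesAux (m : ℕ) (X : Set α) : Prop :=
  ∃ P : Set (Set α), P.Nonempty ∧ X = ⋃₀ P ∧ (∀ S ∈ P, IsSurfaceAux m S) ∧
    ∀ S ∈ P, ∀ T ∈ P, S ≠ T → ∀ x ∈ S, ∀ y ∈ T, ¬ x ≤ y ∧ ¬ y ≤ x

/-- `IsSmoothPCMAux (n + 1) X` means that `X` is a smooth `n`-PCM. -/
def IsSmoothPCMAux : ℕ → Set α → Prop
  | 0, X => X = ∅
  | 1, X => ∃ x : α, X = {x}
  | (n + 2), X => rankSet X = ((n : ℤ) + 1) ∧ IsConnected X ∧ border X ≠ ∅ ∧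
      IsSeparatedUnionOfSurfacesAux (n + 1) (border X) ∧
      ∀ h ∈ X, IsSurfaceAux (n + 1) (thetaS X h) ∨ IsSmoothPCMAux (n + 1) (thetaS X h)

/-- `X` is a smooth `k`-PCM (`k : ℤ`, `k ≥ -1`). -/
def IsSmoothPCM (k : ℤ) (X : Set α) : Prop :=
  ∃ n : ℕ, (n : ℤ) = k + 1 ∧ IsSmoothPCMAux n X

/-- A simplicial complex: a finite family of nonempty finite sets, closed under
taking nonempty subsets and under nonempty intersections. -/
def IsSimplicialComplex {V : Type*} [DecidableEq V] (X : Set (Finset V)) : Prop :=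
  X.Finite ∧ (∀ h ∈ X, h.Nonempty) ∧
  (∀ h ∈ X, ∀ h' : Finset V, h'.Nonempty → h' ⊆ h → h' ∈ X) ∧
  (∀ h ∈ X, ∀ h' ∈ X, (h ∩ h').Nonempty → h ∩ h' ∈ X)

/-- The dimension of a simplex. -/
def dim {V : Type*} (h : Finset V) : ℤ := (h.card : ℤ) - 1

/-- The link of a simplex `h` in a family of simplices `S`. -/
def link {V : Type*} [DecidableEq V] (h : Finset V) (S : Set (Finset V)) : Set (Finset V) :=
  {h' ∈ S | h ∩ h' = ∅ ∧ h ∪ h' ∈ S}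

/-- `X` is pure of rank `n`: every simplex is contained in an `n`-dimensional one. -/
def Pure {V : Type*} (X : Set (Finset V)) (n : ℤ) : Prop :=
  ∀ h ∈ X, ∃ g ∈ X, h ⊆ g ∧ dim g = n

/-- Any two `n`-simplices of `X` are joined by a path in `X` all of whose elements
are simplices of dimension `n - 1` or `n` (i.e. `X` is `(n-1)`-connected). -/
def NConnected {V : Type*} (X : Set (Finset V)) (n : ℤ) : Prop :=
  ∀ a ∈ X, dim a = n → ∀ b ∈ X, dim b = n →
    Relation.ReflTransGen (rel {h | h ∈ X ∧ (dim h = n - 1 ∨ dim h = n)}) a b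

/-- `X` is a pseudomanifold of rank `n`. -/
def IsPseudomanifold {V : Type*} [DecidableEq V] (X : Set (Finset V)) (n : ℤ) : Prop :=
  IsSimplicialComplex X ∧ rankSet X = n ∧
  ((n = 0 ∧ ∃ v : V, X = {({v} : Finset V)}) ∨
   (1 ≤ n ∧ Pure X n ∧
    (∀ h ∈ X, dim h = n - 1 →
      Set.ncard {g | g ∈ X ∧ h ⊆ g ∧ dim g = n} ∈ ({1, 2} : Set ℕ)) ∧
    NConnected X n))

/-- `X` is a normal pseudomanifold of rank `n`: a pseudomanifold such that the link
of every simplex of dimension at most `n - 2` is a pseudomanifold. -/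
def IsNormalPseudomanifold {V : Type*} [DecidableEq V] (X : Set (Finset V)) (n : ℤ) : Prop :=
  IsPseudomanifold X n ∧
  ∀ h ∈ X, dim h ≤ n - 2 → IsPseudomanifold (link h X) (n - dim h - 1)

theorem mem_thetaS {X : Set α} {h x : α} : x ∈ thetaS X h ↔ x ∈ X ∧ (x < h ∨ h < x) := by
  simp only [thetaS, alphaS, betaS, Set.mem_union, Set.mem_ofPred_eq]
  tauto

theorem mem_border {X : Set α} {h : α} :
    h ∈ border X ↔ h ∈ X ∧ ¬ IsSurface (rankSet X - 1) (thetaS X h) := Iff.rfl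

theorem thetaS_thetaS_comm (X : Set α) (h x : α) :
    thetaS (thetaS X h) x = thetaS (thetaS X x) h := by
  ext y
  simp only [mem_thetaS]
  tauto

theorem mem_thetaS_symm {X : Set α} {h x : α} (hh : h ∈ X) (hx : x ∈ thetaS X h) :
    h ∈ thetaS X x :=
  mem_thetaS.2 ⟨hh, (mem_thetaS.1 hx).2.symm⟩

theorem thetaS_union_left {A B : Set α} (hAB : ∀ a ∈ A, ∀ b ∈ B, a < b) {a : α} (ha : a ∈ A) :
    thetaS (A ∪ B) a = thetaS A a ∪ B := by
  ext y
  simp only [mem_thetaS, Set.mem_union]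
  have := hAB a ha y
  tauto

theorem thetaS_union_right {A B : Set α} (hAB : ∀ a ∈ A, ∀ b ∈ B, a < b) {b : α} (hb : b ∈ B) :
    thetaS (A ∪ B) b = A ∪ thetaS B b := by
  ext y
  simp only [mem_thetaS, Set.mem_union]
  have := fun hy => hAB y hy b hb
  tauto

theorem IsSurfaceAux.thetaS {S : Set α} {m : ℕ} (hS : IsSurfaceAux (m + 1) S) {s : α}
    (hs : s ∈ S) : IsSurfaceAux m (thetaS S s) := by
  match m, hS with
  | 0, ⟨x, y, _, hxy, hyx, hS⟩ =>
    subst hS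
    refine Set.eq_empty_iff_forall_notMem.2 fun z hz => ?_
    obtain ⟨hz, hlt⟩ := mem_thetaS.1 hz
    rcases hs with rfl | rfl <;> rcases hz with rfl | rfl <;> simp_all
  | m + 1, hS => exact hS.2.2 s hs

theorem IsSurfaceAux.nonempty {S : Set α} {m : ℕ} (hS : IsSurfaceAux (m + 1) S) :
    S.Nonempty := by
  match m, hS with
  | 0, ⟨x, y, _, _, _, hS⟩ => exact ⟨x, by simp [hS]⟩
  | m + 1, hS => exact hS.1

theorem IsSurfaceAux.exists_succ {S : Set α} {m : ℕ} (hS : IsSurfaceAux m S)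
    (hne : S.Nonempty) : ∃ k, m = k + 1 := by
  cases m with
  | zero => exact absurd hS hne.ne_empty
  | succ k => exact ⟨k, rfl⟩

theorem reflTransGen_rel_of_le {X : Set α} {x y : α} (hx : x ∈ X) (hy : y ∈ X)
    (hxy : x ≤ y ∨ y ≤ x) : Relation.ReflTransGen (rel X) x y := by
  by_cases he : x = y
  · rw [he]
  · exact .single ⟨hx, hy, he, hxy.imp (lt_of_le_of_ne · he) (lt_of_le_of_ne · (Ne.symm he))⟩

theorem isConnected_union {A B : Set α} (hAB : ∀ a ∈ A, ∀ b ∈ B, a < b) (hA : A.Nonempty)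
    (hB : B.Nonempty) : IsConnected (A ∪ B) := by
  obtain ⟨a, ha⟩ := hA
  obtain ⟨b, hb⟩ := hB
  have up : ∀ x ∈ A ∪ B, Relation.ReflTransGen (rel (A ∪ B)) x a ∧
      Relation.ReflTransGen (rel (A ∪ B)) a x := by
    rintro x (hx | hx)
    · have hxb := (hAB x hx b hb).le
      have hab := (hAB a ha b hb).le
      exact ⟨(reflTransGen_rel_of_le (.inl hx) (.inr hb) (.inl hxb)).trans
          (reflTransGen_rel_of_le (.inr hb) (.inl ha) (.inr hab)),
        (reflTransGen_rel_of_le (.inl ha) (.inr hb) (.inl hab)).trans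
          (reflTransGen_rel_of_le (.inr hb) (.inl hx) (.inr hxb))⟩
    · have hax := (hAB a ha x hx).le
      exact ⟨reflTransGen_rel_of_le (.inr hx) (.inl ha) (.inr hax),
        reflTransGen_rel_of_le (.inl ha) (.inr hx) (.inl hax)⟩
  exact fun x hx y hy => (up x hx).1.trans (up y hy).2

/-- The ordinal sum of two surfaces is a surface. -/
theorem IsSurfaceAux.union {p q : ℕ} {A B : Set α} (hA : IsSurfaceAux p A)
    (hB : IsSurfaceAux q B) (hAB : ∀ a ∈ A, ∀ b ∈ B, a < b) :
    IsSurfaceAux (p + q) (A ∪ B) := by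
  induction hm : p + q generalizing p q A B with
  | zero =>
    obtain ⟨rfl, rfl⟩ : p = 0 ∧ q = 0 := by omega
    exact Set.union_empty_iff.2 ⟨hA, hB⟩
  | succ m ih =>
    match p, q, hA, hB with
    | 0, q, hA, hB =>
      obtain rfl : q = m + 1 := by omega
      obtain rfl : A = ∅ := hA
      rwa [Set.empty_union]
    | p + 1, 0, hA, hB =>
      obtain rfl : p = m := by omega
      obtain rfl : B = ∅ := hB
      rwa [Set.union_empty]
    | p + 1, q + 1, hA, hB =>
      obtain ⟨k, rfl⟩ : ∃ k, m = k + 1 := ⟨p + q, by omega⟩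
      refine ⟨hA.nonempty.inl, isConnected_union hAB hA.nonempty hB.nonempty, ?_⟩
      rintro x (hx | hx)
      · rw [thetaS_union_left hAB hx]
        exact ih (hA.thetaS hx) hB
          (fun a ha => hAB a (mem_thetaS.1 ha).1) (by omega)
      · rw [thetaS_union_right hAB hx]
        exact ih hA (hB.thetaS hx)
          (fun a ha b hb => hAB a ha b (mem_thetaS.1 hb).1) (by omega)

/-- If an ordinal sum and its lower part are surfaces, then so is its upper part. -/
theorem IsSurfaceAux.right_of_union {p k : ℕ} {A B : Set α} (hA : IsSurfaceAux p A)
    (hU : IsSurfaceAux k (A ∪ B)) (hAB : ∀ a ∈ A, ∀ b ∈ B, a < b) :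
    ∃ q, k = p + q ∧ IsSurfaceAux q B := by
  induction p generalizing k A with
  | zero =>
    obtain rfl : A = ∅ := hA
    exact ⟨k, by omega, by rwa [Set.empty_union] at hU⟩
  | succ p ih =>
    obtain ⟨a, ha⟩ := hA.nonempty
    obtain ⟨k, rfl⟩ := hU.exists_succ ⟨a, .inl ha⟩
    have hU' := hU.thetaS (.inl ha)
    rw [thetaS_union_left hAB ha] at hU'
    obtain ⟨q, rfl, hq⟩ := ih (hA.thetaS ha) hU' fun a ha => hAB a (mem_thetaS.1 ha).1
    exact ⟨q, by omega, hq⟩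

theorem thetaS_Ioo {x y z : α} (hy : y ∈ Set.Ioo x z) :
    thetaS (Set.Ioo x z) y = Set.Ioo x y ∪ Set.Ioo y z := by
  ext w
  simp only [mem_thetaS, Set.mem_union, Set.mem_Ioo]
  have h₁ : w < y → w < z := fun h => h.trans hy.2
  have h₂ : y < w → x < w := fun h => hy.1.trans h
  tauto

theorem thetaS_eq_union (X : Set α) (h : α) : thetaS X h = alphaS X h ∪ betaS X h := rfl

theorem thetaS_thetaS_of_lt (X : Set α) {x h : α} (hxh : x < h) :
    thetaS (thetaS X h) x = alphaS X x ∪ (X ∩ Set.Ioo x h ∪ betaS X h) := by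
  ext y
  simp only [mem_thetaS, alphaS, betaS, Set.mem_union, Set.mem_inter_iff, Set.mem_Ioo,
    Set.mem_ofPred_eq]
  have h₁ : y < x → y < h := fun hy => hy.trans hxh
  have h₂ : h < y → x < y := fun hy => hxh.trans hy
  tauto

section Finset

variable {V : Type*} [DecidableEq V]

theorem isConnected_Ioo_finset {x z : Finset V} (hc : x.card + 3 ≤ z.card) :
    IsConnected (Set.Ioo x z) := by
  intro y hy w hw
  obtain ⟨a, hay, hax⟩ := Finset.exists_of_ssubset hy.1
  obtain ⟨b, hbw, hbx⟩ := Finset.exists_of_ssubset hw.1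
  have hins : insert a (insert b x) ∈ Set.Ioo x z := by
    refine ⟨(Finset.ssubset_insert hax).trans_subset ?_,
      Finset.ssubset_iff_subset_ne.2 ⟨?_, fun he => ?_⟩⟩
    · exact Finset.insert_subset_insert _ (Finset.subset_insert _ _)
    · exact Finset.insert_subset (hy.2.subset hay) (Finset.insert_subset (hw.2.subset hbw)
        (hy.1.subset.trans hy.2.subset))
    · have h₁ := Finset.card_insert_le a (insert b x)
      have h₂ := Finset.card_insert_le b x
      rw [he] at h₁
      omega
  have hay' : insert a x ⊆ y := Finset.insert_subset hay hy.1.subset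
  have hbw' : insert b x ⊆ w := Finset.insert_subset hbw hw.1.subset
  have ha : insert a x ∈ Set.Ioo x z := ⟨Finset.ssubset_insert hax, lt_of_le_of_lt hay' hy.2⟩
  have hb : insert b x ∈ Set.Ioo x z := ⟨Finset.ssubset_insert hbx, lt_of_le_of_lt hbw' hw.2⟩
  have h₁ : insert a x ⊆ insert a (insert b x) :=
    Finset.insert_subset_insert _ (Finset.subset_insert _ _)
  have h₂ : insert b x ⊆ insert a (insert b x) := Finset.subset_insert _ _
  exact (((reflTransGen_rel_of_le hy ha (.inr hay')).trans
    (reflTransGen_rel_of_le ha hins (.inl h₁))).trans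
    (reflTransGen_rel_of_le hins hb (.inr h₂))).trans
    (reflTransGen_rel_of_le hb hw (.inl hbw'))

/-- Open intervals in the lattice of finite sets are surfaces. -/
theorem isSurfaceAux_Ioo_finset {m : ℕ} {x z : Finset V} (hxz : x ⊆ z)
    (hc : z.card = x.card + m + 1) : IsSurfaceAux m (Set.Ioo x z) := by
  induction m using Nat.strong_induction_on generalizing x z with
  | _ m ih =>
    match m with
    | 0 =>
      refine Set.eq_empty_iff_forall_notMem.2 fun y hy => ?_
      have h₁ := Finset.card_lt_card hy.1
      have h₂ := Finset.card_lt_card hy.2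
      omega
    | 1 =>
      have hsd : (z \ x).card = 2 := by
        have := Finset.card_sdiff_add_card_eq_card hxz
        omega
      obtain ⟨a, b, hab, he⟩ := Finset.card_eq_two.1 hsd
      have ha : a ∈ z \ x := by simp [he]
      have hb : b ∈ z \ x := by simp [he]
      rw [Finset.mem_sdiff] at ha hb
      have hca := Finset.card_insert_of_notMem ha.2
      have hcb := Finset.card_insert_of_notMem hb.2
      refine ⟨insert a x, insert b x, fun h => ?_, fun h => ?_, fun h => ?_, ?_⟩
      · have : a ∈ insert b x := h ▸ Finset.mem_insert_self a x
        simp_all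
      · have := Finset.card_lt_card h
        omega
      · have := Finset.card_lt_card h
        omega
      · have hmem : ∀ c ∈ z, c ∉ x → insert c x ∈ Set.Ioo x z := fun c hcz hcx =>
          ⟨Finset.ssubset_insert hcx, Finset.ssubset_iff_subset_ne.2
            ⟨Finset.insert_subset hcz hxz, fun h => by
              have := Finset.card_insert_of_notMem hcx
              rw [h] at this
              omega⟩⟩
        refine Set.Subset.antisymm (fun y hy => ?_) ?_
        · obtain ⟨c, hcy, hcx⟩ := Finset.exists_of_ssubset hy.1
          have hyc : y = insert c x := by
            refine (Finset.eq_of_subset_of_card_le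
              (Finset.insert_subset hcy hy.1.subset) ?_).symm
            have := Finset.card_lt_card hy.2
            rw [Finset.card_insert_of_notMem hcx]
            omega
          have hc : c ∈ z \ x := Finset.mem_sdiff.2 ⟨hy.2.subset hcy, hcx⟩
          rw [he, Finset.mem_insert, Finset.mem_singleton] at hc
          rcases hc with rfl | rfl
          · exact .inl hyc
          · exact .inr hyc
        · rintro y (rfl | rfl)
          · exact hmem a ha.1 ha.2
          · exact hmem b hb.1 hb.2
    | m + 2 =>
      refine ⟨?_, isConnected_Ioo_finset (by omega), fun y hy => ?_⟩
      · obtain ⟨y, hxy, hyz, hy⟩ := Finset.exists_subsuperset_card_eq hxz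
          (Nat.le_succ x.card) (by omega)
        refine ⟨y, Finset.ssubset_iff_subset_ne.2 ⟨hxy, ?_⟩,
          Finset.ssubset_iff_subset_ne.2 ⟨hyz, ?_⟩⟩ <;> rintro rfl <;> omega
      · have h₁ := Finset.card_lt_card hy.1
        have h₂ := Finset.card_lt_card hy.2
        rw [thetaS_Ioo hy, show m + 1 =
          (y.card - x.card - 1) + (z.card - y.card - 1) by omega]
        exact (ih _ (by omega) hy.1.subset (by omega)).union
          (ih _ (by omega) hy.2.subset (by omega)) fun a ha b hb => ha.2.trans hb.1

theorem IsSimplicialComplex.alphaS_eq_Ioo {X : Set (Finset V)} (hX : IsSimplicialComplex X)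
    {h : Finset V} (hh : h ∈ X) : alphaS X h = Set.Ioo ∅ h := by
  ext y
  refine ⟨fun hy => ⟨Finset.empty_ssubset.2 (hX.2.1 y hy.1), hy.2⟩, fun hy => ⟨?_, hy.2⟩⟩
  exact hX.2.2.1 h hh y (Finset.empty_ssubset.1 hy.1) hy.2.subset

theorem IsSimplicialComplex.inter_Ioo {X : Set (Finset V)} (hX : IsSimplicialComplex X)
    {x h : Finset V} (hh : h ∈ X) : X ∩ Set.Ioo x h = Set.Ioo x h := by
  refine Set.inter_eq_right.2 fun y hy => hX.2.2.1 h hh y ?_ hy.2.subset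
  exact Finset.empty_ssubset.1 ((Finset.empty_subset x).trans_ssubset hy.1)

/-- In a simplicial complex, if the common neighborhood of simplices `x < h` is a surface, then
the neighborhood of `h` is a surface of one dimension more. -/
theorem IsSimplicialComplex.isSurfaceAux_thetaS {X : Set (Finset V)}
    (hX : IsSimplicialComplex X) {x h : Finset V} (hx : x ∈ X) (hh : h ∈ X) (hxh : x < h)
    {k : ℕ} (hk : IsSurfaceAux k (thetaS (thetaS X h) x)) :
    IsSurfaceAux (k + 1) (thetaS X h) := by
  have hc₀ := (hX.2.1 x hx).card_pos
  have hc := Finset.card_lt_card hxh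
  rw [thetaS_thetaS_of_lt X hxh, hX.alphaS_eq_Ioo hx, hX.inter_Ioo hh] at hk
  have sx : IsSurfaceAux (x.card - 1) (Set.Ioo ∅ x) :=
    isSurfaceAux_Ioo_finset (Finset.empty_subset x) (by rw [Finset.card_empty]; omega)
  have sxh : IsSurfaceAux (h.card - x.card - 1) (Set.Ioo x h) :=
    isSurfaceAux_Ioo_finset hxh.subset (by omega)
  have sh : IsSurfaceAux (h.card - 1) (Set.Ioo ∅ h) :=
    isSurfaceAux_Ioo_finset (Finset.empty_subset h) (by rw [Finset.card_empty]; omega)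
  obtain ⟨r, rfl, hr⟩ := sx.right_of_union hk <| by
    rintro a ha b (hb | hb)
    · exact ha.2.trans hb.1
    · exact (ha.2.trans hxh).trans hb.2
  obtain ⟨q, rfl, hq⟩ := sxh.right_of_union hr fun a ha b hb => ha.2.trans hb.2
  have hu := sh.union hq fun a ha b hb => ha.2.trans hb.2
  rw [thetaS_eq_union, hX.alphaS_eq_Ioo hh]
  convert hu using 1
  omega

end Finset

theorem IsCoherent.rankSet_thetaS {X : Set α} (hX : IsCoherent X) {h : α} (hh : h ∈ X) :
    rankSet (thetaS X h) = rankSet X - 1 := by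
  obtain ⟨_ | n, hX⟩ := hX
  · exact absurd hX (Set.nonempty_of_mem hh).ne_empty
  · rcases hX with rfl | hX
    · exact absurd hh (Set.notMem_empty h)
    · exact (hX h hh).1

/-- For a coherent simplicial complex `X` of rank `n ≥ 0` and `h ∈ ΔX`,
`θ□_{ΔX}(h) = Δθ□_X(h)`. -/
theorem statement_6 {V : Type*} [DecidableEq V] (X : Set (Finset V)) (n : ℤ)
    (hsc : IsSimplicialComplex X) (hcoh : IsCoherent X) (hrk : rankSet X = n) (hn : 0 ≤ n)
    (h : Finset V) (hh : h ∈ border X) :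
    thetaS (border X) h = border (thetaS X h) := by
  have hhX := hh.1
  ext x
  rw [mem_thetaS, mem_border (X := thetaS X h), hcoh.rankSet_thetaS hhX]
  constructor
  · rintro ⟨hx, hlt⟩
    refine ⟨mem_thetaS.2 ⟨hx.1, hlt⟩, ?_⟩
    rintro ⟨k, hk, hs⟩
    rcases hlt with hlt | hlt
    · exact hh.2 ⟨k + 1, by push_cast; omega, hsc.isSurfaceAux_thetaS hx.1 hhX hlt hs⟩
    · rw [thetaS_thetaS_comm] at hs
      exact hx.2 ⟨k + 1, by push_cast; omega, hsc.isSurfaceAux_thetaS hhX hx.1 hlt hs⟩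
  · rintro ⟨hx, hns⟩
    refine ⟨⟨(mem_thetaS.1 hx).1, ?_⟩, (mem_thetaS.1 hx).2⟩
    rintro ⟨k, hk, hs⟩
    have hhx := mem_thetaS_symm hhX hx
    obtain ⟨k, rfl⟩ := hs.exists_succ ⟨h, hhx⟩
    refine hns ⟨k, by push_cast at hk; omega, ?_⟩
    rw [thetaS_thetaS_comm]
    exact hs.thetaS hhx

end PCMPaper
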